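/- arXiv:0903.1430 — 3 statements merged into one kernel-verified Lean document; each statement's English description precedes it below -/
import Mathlib

section
/- Let A and B be real numbers. The double inequality √((n + A)/(2π)) < Ω_{n−1}/Ω_n ≤ √((n + B)/(2π)) holds for all positive integers n if and only if A ≤ 1/2 and B ≥ π/2 − 1, where Ω_n = π^{n/2}/Γ(1 + n/2). -/
open Real

/-- `Ω n = π^{n/2}/Γ(1 + n/2)`, the volume of the unit ball in `ℝⁿ`. -/
noncomputable def unitBallVol (n : ℕ) : ℝ :=
  π ^ ((n : ℝ) / 2) / Real.Gamma (1 + (n : ℝ) / 2)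

/-- A positive sequence with `u n * u (n + 1) = (n + 1) ^ 2` and `u n ≤ n + 1`
satisfies `n + 1 / 2 < u n`. -/
theorem add_half_lt_of_mul_succ_eq_sq {u : ℕ → ℝ} (hpos : ∀ n, 0 < u n)
    (hmul : ∀ n : ℕ, u n * u (n + 1) = ((n : ℝ) + 1) ^ 2)
    (hle : ∀ n : ℕ, u n ≤ n + 1) (n : ℕ) : (n : ℝ) + 1 / 2 < u n := by
  have step (m : ℕ) : u (m + 2) * ((m : ℝ) + 1) ^ 2 = u m * ((m : ℝ) + 2) ^ 2 := by
    have h₁ := hmul m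
    have h₂ := hmul (m + 1)
    push_cast at h₂
    linear_combination u (m + 2) * (-h₁) + u m * h₂
  have lower (m : ℕ) : (m : ℝ) ≤ u m := by
    have h₁ := hmul m
    have h₂ := hle (m + 1)
    push_cast at h₂
    by_contra! h
    nlinarith [hpos m, hpos (m + 1), (Nat.cast_nonneg m : (0 : ℝ) ≤ m)]
  have decay {c : ℝ} (hc : 0 ≤ c) (m : ℕ) (h : u m ≤ c * (m + 1 / 2)) :
      u (m + 2) * ((m : ℝ) + 1) ^ 2 ≤
        c * (((m : ℝ) + 2 + 1 / 2) * ((m : ℝ) + 1) ^ 2 - 1 / 2) := by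
    rw [step]
    calc u m * ((m : ℝ) + 2) ^ 2 ≤ c * (m + 1 / 2) * ((m : ℝ) + 2) ^ 2 := by gcongr
      _ = _ := by ring
  by_contra! hn
  obtain ⟨c, hc₀, hc₁, hc⟩ : ∃ c : ℝ, 0 ≤ c ∧ c < 1 ∧
      u (n + 2) ≤ c * (((n + 2 : ℕ) : ℝ) + 1 / 2) := by
    have h := decay zero_le_one n (by linarith)
    have hden : (0 : ℝ) < ((n + 2 : ℕ) : ℝ) + 1 / 2 := by positivity
    refine ⟨u (n + 2) / (((n + 2 : ℕ) : ℝ) + 1 / 2), (div_pos (hpos _) hden).le, ?_, ?_⟩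
    · rw [div_lt_one hden]
      push_cast
      have hsq : (0 : ℝ) < ((n : ℝ) + 1) ^ 2 := by positivity
      by_contra! h'
      nlinarith [mul_le_mul_of_nonneg_right h' hsq.le]
    · rw [div_mul_cancel₀ _ hden.ne']
  have bound (k : ℕ) : u (n + 2 + 2 * k) ≤ c * (((n + 2 + 2 * k : ℕ) : ℝ) + 1 / 2) := by
    induction k with
    | zero => simpa using hc
    | succ k ih =>
      have h := decay hc₀ _ ih
      rw [show n + 2 + 2 * (k + 1) = n + 2 + 2 * k + 2 by ring]
      generalize n + 2 + 2 * k = m at h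
      push_cast
      have hsq : (0 : ℝ) < ((m : ℝ) + 1) ^ 2 := by positivity
      refine le_of_mul_le_mul_right ?_ hsq
      linarith
  obtain ⟨k, hk⟩ := exists_nat_gt (1 / (1 - c))
  rw [div_lt_iff₀ (by linarith)] at hk
  have h₁ := (lower _).trans (bound k)
  push_cast at h₁
  nlinarith [(Nat.cast_nonneg n : (0 : ℝ) ≤ n), (Nat.cast_nonneg k : (0 : ℝ) ≤ k)]

/-- The squared ratio of volumes of consecutive unit balls, scaled by `2 * π`. -/
noncomputable def scaledVolRatioSq (n : ℕ) : ℝ :=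
  2 * (Real.Gamma ((n : ℝ) / 2 + 1) / Real.Gamma ((n : ℝ) / 2 + 1 / 2)) ^ 2

theorem unitBallVol_pos (n : ℕ) : 0 < unitBallVol n :=
  div_pos (rpow_pos_of_pos pi_pos _) (Real.Gamma_pos_of_pos (by positivity))

theorem unitBallVol_ratio_sq {n : ℕ} (hn : 0 < n) :
    (unitBallVol (n - 1) / unitBallVol n) ^ 2 = scaledVolRatioSq n / (2 * π) := by
  obtain ⟨m, rfl⟩ : ∃ m, n = m + 1 := ⟨n - 1, by omega⟩
  simp only [Nat.add_sub_cancel, unitBallVol, scaledVolRatioSq]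
  push_cast
  have h₁ : π ^ (((m : ℝ) + 1) / 2) = π ^ ((m : ℝ) / 2) * √π := by
    rw [sqrt_eq_rpow, ← rpow_add pi_pos]
    ring_nf
  rw [h₁, show 1 + ((m : ℝ) + 1) / 2 = ((m : ℝ) + 1) / 2 + 1 by ring,
    show ((m : ℝ) + 1) / 2 + 1 / 2 = 1 + (m : ℝ) / 2 by ring]
  have hG : Real.Gamma (1 + (m : ℝ) / 2) ≠ 0 := (Real.Gamma_pos_of_pos (by positivity)).ne'
  have hG' : Real.Gamma (((m : ℝ) + 1) / 2 + 1) ≠ 0 :=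
    (Real.Gamma_pos_of_pos (by positivity)).ne'
  have hp : π ^ ((m : ℝ) / 2) ≠ 0 := (rpow_pos_of_pos pi_pos _).ne'
  have hs : √π ≠ 0 := (sqrt_pos.2 pi_pos).ne'
  have hsq : √π ^ 2 = π := sq_sqrt pi_pos.le
  generalize Real.Gamma (1 + (m : ℝ) / 2) = G at *
  generalize Real.Gamma (((m : ℝ) + 1) / 2 + 1) = G' at *
  generalize π ^ ((m : ℝ) / 2) = p at *
  rw [show p / G / (p * √π / G') = G' / G / √π by field_simp, div_pow, hsq]
  field_simp

theorem scaledVolRatioSq_pos (n : ℕ) : 0 < scaledVolRatioSq n := by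
  have h₁ : 0 < Real.Gamma ((n : ℝ) / 2 + 1) := Real.Gamma_pos_of_pos (by positivity)
  have h₂ : 0 < Real.Gamma ((n : ℝ) / 2 + 1 / 2) := Real.Gamma_pos_of_pos (by positivity)
  unfold scaledVolRatioSq
  positivity

theorem scaledVolRatioSq_mul_succ (n : ℕ) :
    scaledVolRatioSq n * scaledVolRatioSq (n + 1) = ((n : ℝ) + 1) ^ 2 := by
  have h₁ : Real.Gamma ((n : ℝ) / 2 + 1) ≠ 0 := (Real.Gamma_pos_of_pos (by positivity)).ne'
  have h₂ : Real.Gamma ((n : ℝ) / 2 + 1 / 2) ≠ 0 :=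
    (Real.Gamma_pos_of_pos (by positivity)).ne'
  unfold scaledVolRatioSq
  push_cast
  rw [show ((n : ℝ) + 1) / 2 + 1 = (n : ℝ) / 2 + 1 / 2 + 1 by ring,
    show ((n : ℝ) + 1) / 2 + 1 / 2 = (n : ℝ) / 2 + 1 by ring,
    Real.Gamma_add_one (s := (n : ℝ) / 2 + 1 / 2) (by positivity)]
  generalize Real.Gamma ((n : ℝ) / 2 + 1) = G at *
  generalize Real.Gamma ((n : ℝ) / 2 + 1 / 2) = G' at *
  field_simp

theorem scaledVolRatioSq_le (n : ℕ) : scaledVolRatioSq n ≤ n + 1 := by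
  have hG : 0 < Real.Gamma ((n : ℝ) / 2 + 1 / 2) := Real.Gamma_pos_of_pos (by positivity)
  have hG₁ : 0 < Real.Gamma ((n : ℝ) / 2 + 1 / 2 + 1) := Real.Gamma_pos_of_pos (by positivity)
  have h := Real.Gamma_mul_add_mul_le_rpow_Gamma_mul_rpow_Gamma
    (s := (n : ℝ) / 2 + 1 / 2) (t := (n : ℝ) / 2 + 1 / 2 + 1) (a := 1 / 2) (b := 1 / 2)
    (by positivity) (by positivity) (by norm_num) (by norm_num) (by norm_num)
  rw [← mul_rpow hG.le hG₁.le, ← sqrt_eq_rpow,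
    show (1 / 2 : ℝ) * ((n : ℝ) / 2 + 1 / 2) + 1 / 2 * ((n : ℝ) / 2 + 1 / 2 + 1) =
      (n : ℝ) / 2 + 1 by ring] at h
  have hsq := (le_sqrt (Real.Gamma_pos_of_pos (by positivity)).le (by positivity)).1 h
  rw [Real.Gamma_add_one (s := (n : ℝ) / 2 + 1 / 2) (by positivity)] at hsq
  unfold scaledVolRatioSq
  rw [div_pow, ← mul_div_assoc, div_le_iff₀ (by positivity)]
  linarith

theorem add_half_lt_scaledVolRatioSq (n : ℕ) : (n : ℝ) + 1 / 2 < scaledVolRatioSq n :=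
  add_half_lt_of_mul_succ_eq_sq scaledVolRatioSq_pos scaledVolRatioSq_mul_succ
    scaledVolRatioSq_le n

theorem scaledVolRatioSq_mul_lt (n : ℕ) :
    scaledVolRatioSq n * ((n : ℝ) + 3 / 2) < ((n : ℝ) + 1) ^ 2 := by
  rw [← scaledVolRatioSq_mul_succ]
  have h := add_half_lt_scaledVolRatioSq (n + 1)
  push_cast at h
  exact mul_lt_mul_of_pos_left (by linarith) (scaledVolRatioSq_pos n)

theorem scaledVolRatioSq_add_two_le (n : ℕ) :
    scaledVolRatioSq (n + 2) ≤ scaledVolRatioSq n + 2 := by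
  have h₁ := scaledVolRatioSq_mul_succ n
  have h₂ := scaledVolRatioSq_mul_succ (n + 1)
  push_cast at h₂
  have h : scaledVolRatioSq (n + 2) * ((n : ℝ) + 1) ^ 2 =
      scaledVolRatioSq n * ((n : ℝ) + 2) ^ 2 := by
    linear_combination scaledVolRatioSq (n + 2) * (-h₁) + scaledVolRatioSq n * h₂
  have hsq : (0 : ℝ) < ((n : ℝ) + 1) ^ 2 := by positivity
  refine le_of_mul_le_mul_right ?_ hsq
  linarith [scaledVolRatioSq_mul_lt n]

theorem scaledVolRatioSq_one : scaledVolRatioSq 1 = π / 2 := by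
  unfold scaledVolRatioSq
  rw [Nat.cast_one, Real.Gamma_add_one (by norm_num), Real.Gamma_one_half_eq,
    show (1 / 2 + 1 / 2 : ℝ) = 1 by norm_num, Real.Gamma_one, div_one, mul_pow,
    sq_sqrt pi_pos.le]
  ring

theorem scaledVolRatioSq_two_le : scaledVolRatioSq 2 ≤ 2 + (π / 2 - 1) := by
  have h := scaledVolRatioSq_mul_succ 1
  rw [scaledVolRatioSq_one] at h
  norm_num at h
  have hpi := pi_gt_d2
  by_contra! h'
  nlinarith [mul_lt_mul_of_pos_left h' pi_pos]

theorem scaledVolRatioSq_succ_le (n : ℕ) :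
    scaledVolRatioSq (n + 1) ≤ ((n + 1 : ℕ) : ℝ) + (π / 2 - 1) := by
  induction n using Nat.twoStepInduction with
  | zero => simp [scaledVolRatioSq_one]
  | one => exact_mod_cast scaledVolRatioSq_two_le
  | more n ih _ =>
    have h := scaledVolRatioSq_add_two_le (n + 1)
    rw [show n + 2 + 1 = n + 1 + 2 by ring]
    push_cast at ih ⊢
    linarith

/-- For real `A`, `B`, the double inequality
`√((n + A)/(2π)) < Ω_{n−1}/Ω_n ≤ √((n + B)/(2π))` holds for all positive
integers `n` if and only if `A ≤ 1/2` and `B ≥ π/2 − 1`. -/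
theorem unit_ball_vol_ratio_bounds_iff (A B : ℝ) :
    (∀ n : ℕ, 0 < n →
      Real.sqrt ((n + A) / (2 * π)) < unitBallVol (n - 1) / unitBallVol n ∧
        unitBallVol (n - 1) / unitBallVol n ≤ Real.sqrt ((n + B) / (2 * π))) ↔
    A ≤ 1 / 2 ∧ B ≥ π / 2 - 1 := by
  have h2pi : 0 < 2 * π := by positivity
  have hpos (n : ℕ) : 0 < unitBallVol (n - 1) / unitBallVol n :=
    div_pos (unitBallVol_pos _) (unitBallVol_pos _)
  have key {n : ℕ} (hn : 0 < n) :
      (√((n + A) / (2 * π)) < unitBallVol (n - 1) / unitBallVol n ↔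
        n + A < scaledVolRatioSq n) ∧
      (unitBallVol (n - 1) / unitBallVol n ≤ √((n + B) / (2 * π)) ↔
        scaledVolRatioSq n ≤ n + B) := by
    rw [sqrt_lt' (hpos n), le_sqrt' (hpos n), unitBallVol_ratio_sq hn,
      div_lt_div_iff_of_pos_right h2pi, div_le_div_iff_of_pos_right h2pi]
    exact ⟨Iff.rfl, Iff.rfl⟩
  constructor
  · intro h
    constructor
    · by_contra! hA
      obtain ⟨k, hk⟩ := exists_nat_gt (1 / (A - 1 / 2))
      rw [div_lt_iff₀ (by linarith)] at hk
      have h₁ := (key k.succ_pos).1.1 (h _ k.succ_pos).1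
      have h₂ := scaledVolRatioSq_mul_lt (k + 1)
      push_cast at h₁ h₂
      have hk₀ : (0 : ℝ) ≤ k := Nat.cast_nonneg k
      nlinarith [mul_lt_mul_of_pos_right h₁ (show (0 : ℝ) < k + 1 + 3 / 2 by positivity)]
    · have h₁ := (key one_pos).2.1 (h 1 one_pos).2
      rw [scaledVolRatioSq_one] at h₁
      push_cast at h₁
      linarith
  · rintro ⟨hA, hB⟩ n hn
    rw [(key hn).1, (key hn).2]
    obtain ⟨m, rfl⟩ : ∃ m, n = m + 1 := ⟨n - 1, by omega⟩
    constructor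
    · linarith [add_half_lt_scaledVolRatioSq (m + 1)]
    · linarith [scaledVolRatioSq_succ_le m]
end

section
/- Let s, t be real numbers with s ≠ t and |s − t| < 1, let α = min{s, t}, and fix c ∈ (−α, ∞). Define g_{s,t}(x) = (1/(t−s)) ∫_c^x ln[ (Γ(u+t)/Γ(u+s)) · (Γ(c+s)/Γ(c+t)) ] du for x ∈ (−α, ∞), and define f_{s,t}(x) = g_{s,t}(x) / ( [g'_{s,t}(x) − 1] e^{g'_{s,t}(x)} + 1 ) for x ≠ c and f_{s,t}(c) = 1/g''_{s,t}(c). Then f_{s,t} is decreasing on (−α, ∞). -/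
open Real

/-- `g_{s,t}(x) = (1/(t−s)) ∫_c^x ln[(Γ(u+t)/Γ(u+s))·(Γ(c+s)/Γ(c+t))] du`. -/
noncomputable def gAux (s t c x : ℝ) : ℝ :=
  (1 / (t - s)) *
    ∫ u in c..x,
      Real.log (Real.Gamma (u + t) / Real.Gamma (u + s) *
        (Real.Gamma (c + s) / Real.Gamma (c + t)))

/-- `f_{s,t}(x) = g_{s,t}(x)/([g'_{s,t}(x) − 1] e^{g'_{s,t}(x)} + 1)` for `x ≠ c`,
and `f_{s,t}(c) = 1/g''_{s,t}(c)`. -/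
noncomputable def fAux (s t c x : ℝ) : ℝ :=
  if x = c then 1 / deriv (deriv (gAux s t c)) c
  else
    gAux s t c x /
      ((deriv (gAux s t c) x - 1) * Real.exp (deriv (gAux s t c) x) + 1)

open Filter Topology Set

/-- Monotone form of l'Hôpital's rule for `g / d ∘ g'`, where `d y = (y - 1) * exp y + 1`:
if `(exp ∘ g')'` is increasing then the quotient, extended by `1 / g''(c)` at the common zero `c`
of `g` and `g'`, is decreasing. -/
lemma antitoneOn_div_sub_one_mul_exp_add_one {a c : ℝ} (hc : a < c) {g G G' : ℝ → ℝ}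
    (hg : ∀ x, a < x → HasDerivAt g (G x) x) (hG : ∀ x, a < x → HasDerivAt G (G' x) x)
    (hgc : g c = 0) (hGc : G c = 0) (hpos : ∀ x, a < x → 0 < G' x)
    (hmono : MonotoneOn (fun x => G' x * exp (G x)) (Ioi a)) :
    AntitoneOn (fun x => if x = c then 1 / G' c else g x / ((G x - 1) * exp (G x) + 1))
      (Ioi a) := by
  set M : ℝ → ℝ := fun x => G' x * exp (G x) with hM
  set d : ℝ → ℝ := fun x => (G x - 1) * exp (G x) + 1 with hd
  have hGcont : ContinuousOn G (Ioi a) := fun x hx => (hG x hx).continuousAt.continuousWithinAt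
  have hGmono : StrictMonoOn G (Ioi a) := by
    refine strictMonoOn_of_deriv_pos (convex_Ioi a) hGcont fun x hx => ?_
    rw [interior_Ioi] at hx
    rw [(hG x hx).deriv]
    exact hpos x hx
  have hGneg : ∀ x, a < x → x < c → G x < 0 := fun x hx hxc => hGc ▸ hGmono hx hc hxc
  have hGpos : ∀ x, c < x → 0 < G x := fun x hxc =>
    hGc ▸ hGmono (mem_Ioi.2 hc) (hc.trans hxc) hxc
  have hdpos : ∀ x, G x ≠ 0 → 0 < d x := by
    intro x hx
    have h1 := add_one_lt_exp (neg_ne_zero.2 hx)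
    have h2 : exp (-G x) * exp (G x) = 1 := by rw [← exp_add]; simp
    have h3 := exp_pos (G x)
    simp only [hd]
    nlinarith
  have hdc : d c = 0 := by simp [hd, hGc]
  have hMc : M c = G' c := by simp [hM, hGc]
  have hdd : ∀ x, a < x → HasDerivAt d (G x * M x) x := by
    intro x hx
    have := (((hG x hx).sub_const 1).mul (hG x hx).exp).add_const 1
    refine this.congr_deriv ?_
    simp only [hM]
    ring
  have hdiff : ∀ k x, a < x →
      HasDerivAt (fun u => d u - k * g u) (G x * (M x - k)) x := by
    intro k x hx
    exact ((hdd x hx).sub ((hg x hx).const_mul k)).congr_deriv (by ring)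
  have hcontdiff : ∀ k, ∀ S ⊆ Ioi a, ContinuousOn (fun u => d u - k * g u) S := fun k S hS x hx =>
    (hdiff k x (hS hx)).continuousAt.continuousWithinAt
  have hright : ∀ x, c < x → d x - M x * g x ≤ 0 := by
    intro x hx
    have hsub : Icc c x ⊆ Ioi a := fun u hu => hc.trans_le hu.1
    have := antitoneOn_of_hasDerivWithinAt_nonpos (convex_Icc c x)
      (hcontdiff (M x) _ hsub)
      (fun u hu => (hdiff (M x) u (hsub (interior_subset hu))).hasDerivWithinAt) (by
        intro u hu
        rw [interior_Icc] at hu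
        have h1 := hGpos u hu.1
        have h2 : M u ≤ M x := hmono (hc.trans hu.1) (hc.trans hx) hu.2.le
        nlinarith) (left_mem_Icc.2 hx.le) (right_mem_Icc.2 hx.le) hx.le
    simpa [hdc, hgc] using this
  have hleft : ∀ x, a < x → x < c → 0 ≤ d x - M x * g x := by
    intro x hax hx
    have hsub : Icc x c ⊆ Ioi a := fun u hu => hax.trans_le hu.1
    have := antitoneOn_of_hasDerivWithinAt_nonpos (convex_Icc x c)
      (hcontdiff (M x) _ hsub)
      (fun u hu => (hdiff (M x) u (hsub (interior_subset hu))).hasDerivWithinAt) (by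
        intro u hu
        rw [interior_Icc] at hu
        have h1 := hGneg u (hax.trans hu.1) hu.2
        have h2 : M x ≤ M u := hmono hax (hax.trans hu.1) hu.1.le
        nlinarith) (left_mem_Icc.2 hx.le) (right_mem_Icc.2 hx.le) hx.le
    simpa [hdc, hgc] using this
  have hcmono : MonotoneOn (fun u => d u - M c * g u) (Ioi a) := by
    refine monotoneOn_of_hasDerivWithinAt_nonneg (convex_Ioi a) (hcontdiff (M c) _ subset_rfl)
      (fun u hu => (hdiff (M c) u (interior_subset hu)).hasDerivWithinAt) ?_
    intro u hu
    rw [interior_Ioi] at hu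
    rcases le_total u c with huc | huc
    · have h1 : G u ≤ G c := hGmono.monotoneOn hu hc huc
      have h2 : M u ≤ M c := hmono hu hc huc
      rw [hGc] at h1
      nlinarith
    · have h1 : G c ≤ G u := hGmono.monotoneOn hc hu huc
      have h2 : M c ≤ M u := hmono hc hu huc
      rw [hGc] at h1
      nlinarith
  have hcright : ∀ x, c < x → g x / d x ≤ 1 / G' c := by
    intro x hx
    have h1 := hcmono hc (mem_Ioi.2 (hc.trans hx)) hx.le
    simp only [hdc, hgc, hMc] at h1
    rw [div_le_div_iff₀ (hdpos x (hGpos x hx).ne') (hpos c hc)]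
    linarith
  have hcleft : ∀ x, a < x → x < c → 1 / G' c ≤ g x / d x := by
    intro x hax hx
    have h1 := hcmono (mem_Ioi.2 hax) hc hx.le
    simp only [hdc, hgc, hMc] at h1
    rw [div_le_div_iff₀ (hpos c hc) (hdpos x (hGneg x hax hx).ne)]
    linarith
  have hquot : ∀ x, a < x → G x ≠ 0 → HasDerivAt (fun u => g u / d u)
      (G x * (d x - M x * g x) / d x ^ 2) x := by
    intro x hx hGx
    exact ((hg x hx).div (hdd x hx) (hdpos x hGx).ne').congr_deriv (by ring)
  have hantiR : AntitoneOn (fun u => g u / d u) (Ioi c) := by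
    have hq : ∀ x ∈ Ioi c, _ := fun x hx => hquot x (hc.trans hx) (hGpos x hx).ne'
    refine antitoneOn_of_hasDerivWithinAt_nonpos (convex_Ioi c)
      (fun x hx => (hq x hx).continuousAt.continuousWithinAt)
      (fun x hx => (hq x (interior_subset hx)).hasDerivWithinAt) ?_
    intro x hx
    rw [interior_Ioi] at hx
    exact div_nonpos_of_nonpos_of_nonneg
      (mul_nonpos_of_nonneg_of_nonpos (hGpos x hx).le (hright x hx)) (sq_nonneg _)
  have hantiL : AntitoneOn (fun u => g u / d u) (Ioo a c) := by
    have hq : ∀ x ∈ Ioo a c, _ := fun x hx => hquot x hx.1 (hGneg x hx.1 hx.2).ne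
    refine antitoneOn_of_hasDerivWithinAt_nonpos (convex_Ioo a c)
      (fun x hx => (hq x hx).continuousAt.continuousWithinAt)
      (fun x hx => (hq x (interior_subset hx)).hasDerivWithinAt) ?_
    intro x hx
    rw [interior_Ioo] at hx
    exact div_nonpos_of_nonpos_of_nonneg
      (mul_nonpos_of_nonpos_of_nonneg (hGneg x hx.1 hx.2).le (hleft x hx.1 hx.2)) (sq_nonneg _)
  intro x hx y hy hxy
  rcases lt_trichotomy x c with hxc | hxc | hxc <;> rcases lt_trichotomy y c with hyc | hyc | hyc
  · simpa only [hxc.ne, hyc.ne, if_false] using hantiL ⟨hx, hxc⟩ ⟨hy, hyc⟩ hxy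
  · simpa only [hxc.ne, hyc, if_false, if_true] using hcleft x hx hxc
  · simpa only [hxc.ne, hyc.ne', if_false] using (hcright y hyc).trans (hcleft x hx hxc)
  · exact absurd hxy (not_le.2 (hxc ▸ hyc))
  · simp [hxc, hyc]
  · simpa only [hxc, hyc.ne', if_false, if_true] using hcright y hyc
  · exact absurd hxy (not_le.2 (hyc.trans hxc))
  · exact absurd hxy (not_le.2 (hyc ▸ hxc))
  · simpa only [hxc.ne', hyc.ne', if_false] using hantiR hxc hyc hxy

lemma hasDerivAt_log_sub_log_div {s t x : ℝ} (hst : s ≠ t) (hs : 0 < x + s) (ht : 0 < x + t) :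
    HasDerivAt (fun x => 1 / (t - s) * (log (x + s) - log (x + t)))
      (1 / ((x + s) * (x + t))) x := by
  have hts : t - s ≠ 0 := sub_ne_zero.2 hst.symm
  refine (((((hasDerivAt_id x).add_const s).log hs.ne').sub
    (((hasDerivAt_id x).add_const t).log ht.ne')).const_mul (1 / (t - s))).congr_deriv ?_
  simp only [id]
  field_simp
  ring

/-- Truncated Euler product for `log (Γ(x+t) / Γ(x+s)) / (t - s)`, with tail `x + N + (s+t-1)/2`. -/
noncomputable def logGammaRatioSeq (s t : ℝ) (N : ℕ) (x : ℝ) : ℝ :=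
  log (x + N + (s + t - 1) / 2) +
    1 / (t - s) * ∑ m ∈ Finset.range N, (log (x + m + s) - log (x + m + t))

/-- The derivative of `logGammaRatioSeq`. -/
noncomputable def logGammaRatioSeqDeriv (s t : ℝ) (N : ℕ) (x : ℝ) : ℝ :=
  1 / (x + N + (s + t - 1) / 2) + ∑ m ∈ Finset.range N, 1 / ((x + m + s) * (x + m + t))

/-- The second derivative of `logGammaRatioSeq`. -/
noncomputable def logGammaRatioSeqDeriv₂ (s t : ℝ) (N : ℕ) (x : ℝ) : ℝ :=
  -1 / (x + N + (s + t - 1) / 2) ^ 2 -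
    ∑ m ∈ Finset.range N, (2 * (x + m) + s + t) / ((x + m + s) * (x + m + t)) ^ 2

lemma hasDerivAt_logGammaRatioSeq {s t x : ℝ} {N : ℕ} (hst : s ≠ t) (hs : 0 < x + s)
    (ht : 0 < x + t) (hN : 1 < 2 * x + s + t + 2 * N) :
    HasDerivAt (logGammaRatioSeq s t N) (logGammaRatioSeqDeriv s t N x) x := by
  have hts : t - s ≠ 0 := sub_ne_zero.2 hst.symm
  have h1 : HasDerivAt (fun y : ℝ => log (y + N + (s + t - 1) / 2))
      (1 / (x + N + (s + t - 1) / 2)) x :=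
    (((hasDerivAt_id x).add_const _).add_const _).log (by simp only [id]; linarith)
  have h2 : ∀ m ∈ Finset.range N,
      HasDerivAt (fun y : ℝ => log (y + m + s) - log (y + m + t))
        (1 / (x + m + s) - 1 / (x + m + t)) x := by
    intro m _
    have hm : (0 : ℝ) ≤ m := m.cast_nonneg
    exact ((((hasDerivAt_id x).add_const _).add_const _).log
      (by simp only [id]; linarith)).sub ((((hasDerivAt_id x).add_const _).add_const _).log
      (by simp only [id]; linarith))
  refine (h1.add ((HasDerivAt.fun_sum h2).const_mul (1 / (t - s)))).congr_deriv ?_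
  rw [logGammaRatioSeqDeriv, Finset.mul_sum]
  congr 1
  refine Finset.sum_congr rfl fun m _ => ?_
  have hm : (0 : ℝ) ≤ m := m.cast_nonneg
  have h3 : x + m + s ≠ 0 := by linarith
  have h4 : x + m + t ≠ 0 := by linarith
  field_simp
  ring

lemma hasDerivAt_logGammaRatioSeqDeriv {s t x : ℝ} {N : ℕ} (hs : 0 < x + s)
    (ht : 0 < x + t) (hN : 1 < 2 * x + s + t + 2 * N) :
    HasDerivAt (logGammaRatioSeqDeriv s t N) (logGammaRatioSeqDeriv₂ s t N x) x := by
  have h1 : HasDerivAt (fun y : ℝ => 1 / (y + N + (s + t - 1) / 2))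
      (-1 / (x + N + (s + t - 1) / 2) ^ 2) x := by
    simpa only [one_div, id] using (((hasDerivAt_id x).add_const (N : ℝ)).add_const
      ((s + t - 1) / 2)).fun_inv (by simp only [id]; linarith)
  have h2 : ∀ m ∈ Finset.range N,
      HasDerivAt (fun y : ℝ => 1 / ((y + m + s) * (y + m + t)))
        (-((2 * (x + m) + s + t) / ((x + m + s) * (x + m + t)) ^ 2)) x := by
    intro m _
    have hm : (0 : ℝ) ≤ m := m.cast_nonneg
    have h3 : x + m + s ≠ 0 := by linarith
    have h4 : x + m + t ≠ 0 := by linarith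
    have := ((((hasDerivAt_id x).add_const (m : ℝ)).add_const s).fun_mul
      (((hasDerivAt_id x).add_const (m : ℝ)).add_const t)).fun_inv (mul_ne_zero h3 h4)
    simp only [id] at this
    simp only [one_div]
    exact this.congr_deriv (by ring)
  refine (h1.add (HasDerivAt.fun_sum h2)).congr_deriv ?_
  rw [logGammaRatioSeqDeriv₂, Finset.sum_neg_distrib, ← sub_eq_add_neg]

lemma logGammaRatioSeqDeriv_succ (s t : ℝ) (N : ℕ) (x : ℝ) :
    logGammaRatioSeqDeriv s t (N + 1) x =
      logGammaRatioSeqDeriv s t N (x + 1) + 1 / ((x + s) * (x + t)) := by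
  have e : ∀ m : ℕ, x + ((m + 1 : ℕ) : ℝ) = x + 1 + m := fun m => by push_cast; ring
  simp only [logGammaRatioSeqDeriv, Finset.sum_range_succ', e, Nat.cast_zero, add_zero]
  ring

lemma logGammaRatioSeqDeriv₂_succ (s t : ℝ) (N : ℕ) (x : ℝ) :
    logGammaRatioSeqDeriv₂ s t (N + 1) x =
      logGammaRatioSeqDeriv₂ s t N (x + 1) - (2 * x + s + t) / ((x + s) * (x + t)) ^ 2 := by
  have e : ∀ m : ℕ, x + ((m + 1 : ℕ) : ℝ) = x + 1 + m := fun m => by push_cast; ring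
  simp only [logGammaRatioSeqDeriv₂, Finset.sum_range_succ', e, Nat.cast_zero, add_zero]
  ring

lemma logGammaRatioSeqDeriv_bounds {s t : ℝ} (h : |s - t| < 1) (N : ℕ) :
    ∀ x, 0 < x + s → 0 < x + t → 1 < 2 * x + s + t + 2 * N →
      (1 + 2 * x + s + t) / ((x + s) * (x + t)) ≤ 2 * logGammaRatioSeqDeriv s t N x ∧
        0 ≤ logGammaRatioSeqDeriv s t N x ^ 2 + logGammaRatioSeqDeriv₂ s t N x := by
  have hsq : (s - t) ^ 2 < 1 := by rwa [sq_lt_one_iff_abs_lt_one]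
  induction N with
  | zero =>
    intro x hs ht hN
    simp only [Nat.cast_zero, mul_zero, add_zero] at hN
    have hw : 0 < x + (s + t - 1) / 2 := by linarith
    simp only [logGammaRatioSeqDeriv, logGammaRatioSeqDeriv₂, Finset.range_zero, Finset.sum_empty,
      Nat.cast_zero, add_zero, sub_zero]
    constructor
    · rw [mul_one_div, div_le_div_iff₀ (by positivity) hw]
      nlinarith
    · rw [div_pow, ← add_div]
      norm_num
  | succ N ih =>
    intro x hs ht hN
    push_cast at hN
    obtain ⟨h1, h2⟩ := ih (x + 1) (by linarith) (by linarith) (by linarith)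
    rw [logGammaRatioSeqDeriv_succ, logGammaRatioSeqDeriv₂_succ]
    set U := logGammaRatioSeqDeriv s t N (x + 1)
    set V := logGammaRatioSeqDeriv₂ s t N (x + 1)
    have hp : 0 < (x + s) * (x + t) := by positivity
    have hp' : 0 < (x + 1 + s) * (x + 1 + t) := by
      have : 0 < x + 1 + s := by linarith
      have : 0 < x + 1 + t := by linarith
      positivity
    have key : (2 * x + s + t - 1) / ((x + s) * (x + t)) ≤ 2 * U := by
      refine le_trans ?_ h1
      rw [div_le_div_iff₀ hp hp']
      nlinarith
    constructor
    · have e : (1 + 2 * x + s + t) / ((x + s) * (x + t)) =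
          (2 * x + s + t - 1) / ((x + s) * (x + t)) + 2 * (1 / ((x + s) * (x + t))) := by ring
      rw [e]
      linarith
    · have e : (U + 1 / ((x + s) * (x + t))) ^ 2 +
          (V - (2 * x + s + t) / ((x + s) * (x + t)) ^ 2) = (U ^ 2 + V) +
          1 / ((x + s) * (x + t)) * (2 * U - (2 * x + s + t - 1) / ((x + s) * (x + t))) := by
        field_simp
        ring
      rw [e]
      have : 0 ≤ 1 / ((x + s) * (x + t)) := by positivity
      have := mul_nonneg this (sub_nonneg.2 key)
      linarith

lemma tendsto_logGammaRatioSeq {s t x : ℝ} (hst : s ≠ t) (hs : 0 < x + s) (ht : 0 < x + t) :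
    Tendsto (fun n : ℕ => logGammaRatioSeq s t (n + 1) x) atTop
      (𝓝 (1 / (t - s) * (log (Gamma (x + t)) - log (Gamma (x + s))))) := by
  have hts : t - s ≠ 0 := sub_ne_zero.2 hst.symm
  have h1 := ((Real.BohrMollerup.tendsto_log_gamma ht).sub
    (Real.BohrMollerup.tendsto_log_gamma hs)).const_mul (1 / (t - s))
  have h2 : Tendsto (fun n : ℕ => log (1 + (x + 1 + (s + t - 1) / 2) / n)) atTop (𝓝 0) := by
    have h3 : Tendsto (fun n : ℕ => 1 + (x + 1 + (s + t - 1) / 2) / (n : ℝ)) atTop (𝓝 1) := by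
      simpa using (tendsto_const_div_atTop_nhds_zero_nat (x + 1 + (s + t - 1) / 2)).const_add 1
    simpa using h3.log one_ne_zero
  have h4 := h1.add h2
  rw [add_zero] at h4
  refine h4.congr' ?_
  filter_upwards [eventually_ge_atTop 1] with n hn
  have hn0 : (0 : ℝ) < n := by exact_mod_cast hn
  have e : log (x + (n + 1 : ℕ) + (s + t - 1) / 2) =
      log n + log (1 + (x + 1 + (s + t - 1) / 2) / n) := by
    have hw : 0 < x + 1 + (s + t - 1) / 2 := by linarith
    rw [← log_mul hn0.ne' (by positivity)]
    congr 1
    push_cast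
    field_simp
    ring
  rw [logGammaRatioSeq, e, BohrMollerup.logGammaSeq, BohrMollerup.logGammaSeq,
    Finset.sum_sub_distrib]
  simp only [add_right_comm x _ s, add_right_comm x _ t]
  field_simp
  ring

section GammaRatio

variable {s t : ℝ}

lemma pos_of_mem_Ioi_neg_min {x : ℝ} (hx : x ∈ Ioi (-(min s t))) : 0 < x + s ∧ 0 < x + t := by
  have := mem_Ioi.1 hx
  have := min_le_left s t
  have := min_le_right s t
  constructor <;> linarith

/-- The function `(Γ(x+t) / Γ(x+s)) ^ (1 / (t - s))` is convex when `|s - t| < 1`. -/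
lemma convexOn_exp_log_Gamma_ratio (hst : s ≠ t) (h : |s - t| < 1) :
    ConvexOn ℝ (Ioi (-(min s t)))
      (fun x => exp (1 / (t - s) * (log (Gamma (x + t)) - log (Gamma (x + s))))) := by
  have hconv : ∀ N : ℕ, ConvexOn ℝ (Ioi (-(min s t)))
      (fun x => exp (logGammaRatioSeq s t (N + 1) x)) := by
    intro N
    have hN : ∀ x ∈ Ioi (-(min s t)), 1 < 2 * x + s + t + 2 * ((N + 1 : ℕ) : ℝ) := by
      intro x hx
      have := pos_of_mem_Ioi_neg_min hx
      have : (0 : ℝ) ≤ N := N.cast_nonneg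
      push_cast
      linarith
    have hd : ∀ x ∈ Ioi (-(min s t)), _ := fun x hx => (hasDerivAt_logGammaRatioSeq hst
      (pos_of_mem_Ioi_neg_min hx).1 (pos_of_mem_Ioi_neg_min hx).2 (hN x hx)).exp
    refine convexOn_of_hasDerivWithinAt2_nonneg (convex_Ioi _)
      (f' := fun x => exp (logGammaRatioSeq s t (N + 1) x) * logGammaRatioSeqDeriv s t (N + 1) x)
      (f'' := fun x => exp (logGammaRatioSeq s t (N + 1) x) *
        (logGammaRatioSeqDeriv s t (N + 1) x ^ 2 + logGammaRatioSeqDeriv₂ s t (N + 1) x))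
      (fun x hx => (hd x hx).continuousAt.continuousWithinAt)
      (fun x hx => (hd x (interior_subset hx)).hasDerivWithinAt) (fun x hx => ?_) (fun x hx => ?_)
    · have hx' := interior_subset hx
      have := (hasDerivAt_logGammaRatioSeq hst (pos_of_mem_Ioi_neg_min hx').1
        (pos_of_mem_Ioi_neg_min hx').2 (hN x hx')).exp.fun_mul
        (hasDerivAt_logGammaRatioSeqDeriv
          (pos_of_mem_Ioi_neg_min hx').1 (pos_of_mem_Ioi_neg_min hx').2 (hN x hx'))
      exact (this.congr_deriv (by ring)).hasDerivWithinAt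
    · have hx' := interior_subset hx
      exact mul_nonneg (exp_pos _).le (logGammaRatioSeqDeriv_bounds h (N + 1) x
        (pos_of_mem_Ioi_neg_min hx').1 (pos_of_mem_Ioi_neg_min hx').2 (hN x hx')).2
  have hlim : ∀ x ∈ Ioi (-(min s t)), _ := fun x hx =>
    (continuous_exp.tendsto _).comp (tendsto_logGammaRatioSeq hst
      (pos_of_mem_Ioi_neg_min hx).1 (pos_of_mem_Ioi_neg_min hx).2)
  refine ⟨convex_Ioi _, fun x hx y hy a b ha hb hab => ?_⟩
  exact le_of_tendsto_of_tendsto' (hlim _ (convex_Ioi _ hx hy ha hb hab))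
    (((hlim x hx).const_smul a).add ((hlim y hy).const_smul b))
    fun N => (hconv N).2 hx hy ha hb hab

lemma monotoneOn_log_Gamma_ratio_sub (hst : s ≠ t) :
    MonotoneOn (fun x => 1 / (t - s) * (log (Gamma (x + t)) - log (Gamma (x + s))) -
      1 / (t - s) * (log (x + s) - log (x + t))) (Ioi (-(min s t))) := by
  have hmono : ∀ N : ℕ, MonotoneOn (fun x => logGammaRatioSeq s t (N + 1) x -
      1 / (t - s) * (log (x + s) - log (x + t))) (Ioi (-(min s t))) := by
    intro N
    have hd : ∀ x ∈ Ioi (-(min s t)), _ := fun x hx => (hasDerivAt_logGammaRatioSeq (N := N + 1) hst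
      (pos_of_mem_Ioi_neg_min hx).1 (pos_of_mem_Ioi_neg_min hx).2 (by
        have := pos_of_mem_Ioi_neg_min hx
        have : (0 : ℝ) ≤ N := N.cast_nonneg
        push_cast
        linarith)).fun_sub
      (hasDerivAt_log_sub_log_div hst
        (pos_of_mem_Ioi_neg_min hx).1 (pos_of_mem_Ioi_neg_min hx).2)
    refine monotoneOn_of_hasDerivWithinAt_nonneg (convex_Ioi _)
      (fun x hx => (hd x hx).continuousAt.continuousWithinAt)
      (fun x hx => (hd x (interior_subset hx)).hasDerivWithinAt) fun x hx => ?_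
    obtain ⟨h1, h2⟩ := pos_of_mem_Ioi_neg_min (interior_subset hx)
    have hN : (0 : ℝ) ≤ N := N.cast_nonneg
    rw [logGammaRatioSeqDeriv_succ, add_sub_cancel_right, logGammaRatioSeqDeriv]
    refine add_nonneg (one_div_nonneg.2 (by linarith)) (Finset.sum_nonneg fun m _ => ?_)
    have hm : (0 : ℝ) ≤ m := m.cast_nonneg
    exact one_div_nonneg.2 (mul_nonneg (by linarith) (by linarith))
  have hlim : ∀ x ∈ Ioi (-(min s t)), _ := fun x hx =>
    (tendsto_logGammaRatioSeq hst
      (pos_of_mem_Ioi_neg_min hx).1 (pos_of_mem_Ioi_neg_min hx).2).sub_const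
      (1 / (t - s) * (log (x + s) - log (x + t)))
  intro x hx y hy hxy
  exact le_of_tendsto_of_tendsto' (hlim x hx) (hlim y hy) fun N => hmono N hx hy hxy

lemma differentiableAt_log_Gamma_ratio {x : ℝ} (hs : 0 < x + s) (ht : 0 < x + t) :
    DifferentiableAt ℝ
      (fun x => 1 / (t - s) * (log (Gamma (x + t)) - log (Gamma (x + s)))) x := by
  have hΓ : ∀ r, 0 < x + r → DifferentiableAt ℝ (fun x => log (Gamma (x + r))) x := by
    intro r hr
    have h1 : DifferentiableAt ℝ Gamma (x + r) := differentiableAt_Gamma fun m => by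
      have : (0 : ℝ) ≤ m := m.cast_nonneg
      linarith
    have h2 : DifferentiableAt ℝ (fun x => Gamma (x + r)) x :=
      DifferentiableAt.comp (g := Gamma) x h1 (differentiableAt_id.add_const r)
    exact h2.log (Gamma_pos_of_pos hr).ne'
  exact ((hΓ t ht).sub (hΓ s hs)).const_mul _

lemma deriv_log_Gamma_ratio_pos (hst : s ≠ t) {x : ℝ} (hx : x ∈ Ioi (-(min s t))) :
    0 < deriv (fun x => 1 / (t - s) * (log (Gamma (x + t)) - log (Gamma (x + s)))) x := by
  obtain ⟨h1, h2⟩ := pos_of_mem_Ioi_neg_min hx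
  have hd := (differentiableAt_log_Gamma_ratio h1 h2).hasDerivAt.fun_sub
    (hasDerivAt_log_sub_log_div hst h1 h2)
  have h3 := (monotoneOn_log_Gamma_ratio_sub hst).derivWithin_nonneg (x := x)
  rw [hd.hasDerivWithinAt.derivWithin (isOpen_Ioi.uniqueDiffWithinAt hx)] at h3
  have : 0 < 1 / ((x + s) * (x + t)) := by positivity
  linarith

end GammaRatio

/-- For `s ≠ t` with `|s − t| < 1` and `c ∈ (−min{s,t}, ∞)`, the function
`f_{s,t}` is decreasing on `(−min{s,t}, ∞)`. -/
theorem fAux_antitoneOn (s t c : ℝ) (hst : s ≠ t) (h : |s - t| < 1)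
    (hc : c ∈ Set.Ioi (-(min s t))) :
    AntitoneOn (fAux s t c) (Set.Ioi (-(min s t))) := by
  set D := Ioi (-(min s t))
  set L : ℝ → ℝ := fun x => 1 / (t - s) * (log (Gamma (x + t)) - log (Gamma (x + s))) with hL
  set I : ℝ → ℝ := fun u => log (Gamma (u + t) / Gamma (u + s) *
    (Gamma (c + s) / Gamma (c + t))) with hI
  have hLd : ∀ x ∈ D, DifferentiableAt ℝ L x := fun x hx =>
    differentiableAt_log_Gamma_ratio (pos_of_mem_Ioi_neg_min hx).1 (pos_of_mem_Ioi_neg_min hx).2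
  have hLI : ∀ x ∈ D, 1 / (t - s) * I x = L x - L c := by
    intro x hx
    obtain ⟨h1, h2⟩ := pos_of_mem_Ioi_neg_min hx
    obtain ⟨h3, h4⟩ := pos_of_mem_Ioi_neg_min hc
    have g1 := (Gamma_pos_of_pos h1).ne'
    have g2 := (Gamma_pos_of_pos h2).ne'
    have g3 := (Gamma_pos_of_pos h3).ne'
    have g4 := (Gamma_pos_of_pos h4).ne'
    simp only [hI, hL]
    rw [log_mul (div_ne_zero g2 g1) (div_ne_zero g3 g4), log_div g2 g1, log_div g3 g4]
    ring
  have hLcont : ContinuousOn (fun x => L x - L c) D := fun x hx =>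
    ((hLd x hx).continuousAt.sub continuousAt_const).continuousWithinAt
  have hgL : EqOn (gAux s t c) (fun x => ∫ u in c..x, (L u - L c)) D := by
    intro x hx
    rw [gAux, ← intervalIntegral.integral_const_mul]
    exact intervalIntegral.integral_congr fun u hu =>
      hLI u ((ordConnected_Ioi.uIcc_subset hc hx) hu)
  have hgd : ∀ x ∈ D, HasDerivAt (gAux s t c) (L x - L c) x := by
    intro x hx
    have hint := intervalIntegral.integral_hasDerivAt_right
      ((hLcont.mono (ordConnected_Ioi.uIcc_subset hc hx)).intervalIntegrable)
      (hLcont.stronglyMeasurableAtFilter isOpen_Ioi x hx)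
      (hLcont.continuousAt (isOpen_Ioi.mem_nhds hx))
    exact hint.congr_of_eventuallyEq (hgL.eventuallyEq_of_mem (isOpen_Ioi.mem_nhds hx))
  have hGd : ∀ x ∈ D, HasDerivAt (fun x => L x - L c) (deriv L x) x := fun x hx =>
    (hLd x hx).hasDerivAt.sub_const _
  have hexp : MonotoneOn (fun x => deriv L x * exp (L x - L c)) D := by
    have h1 := (convexOn_exp_log_Gamma_ratio hst h).monotoneOn_deriv fun x hx => (hLd x hx).exp
    intro x hx y hy hxy
    have h2 := h1 hx hy hxy
    rw [((hLd x hx).hasDerivAt.exp).deriv, ((hLd y hy).hasDerivAt.exp).deriv] at h2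
    simp only [exp_sub, ← mul_div_assoc]
    rw [mul_comm (deriv L x), mul_comm (deriv L y)]
    exact div_le_div_of_nonneg_right h2 (exp_pos _).le
  refine (antitoneOn_div_sub_one_mul_exp_add_one (mem_Ioi.1 hc) hgd hGd (by simp [gAux])
    (sub_self _) (fun x hx => deriv_log_Gamma_ratio_pos hst hx) hexp).congr ?_
  intro x hx
  have hderiv : deriv (deriv (gAux s t c)) c = deriv L c := by
    have : deriv (gAux s t c) =ᶠ[𝓝 c] fun x => L x - L c := by
      filter_upwards [isOpen_Ioi.mem_nhds hc] with y hy using (hgd y hy).deriv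
    rw [this.deriv_eq, (hGd c hc).deriv]
  simp only [fAux, hderiv, (hgd x hx).deriv]
end

section
/- Let s, t be real numbers with |s − t| > 1, let α = min{s, t}, and fix c ∈ (−α, ∞). Define g_{s,t}(x) = (1/(t−s)) ∫_c^x ln[ (Γ(u+t)/Γ(u+s)) · (Γ(c+s)/Γ(c+t)) ] du for x ∈ (−α, ∞), and define f_{s,t}(x) = g_{s,t}(x) / ( [g'_{s,t}(x) − 1] e^{g'_{s,t}(x)} + 1 ) for x ≠ c and f_{s,t}(c) = 1/g''_{s,t}(c). Then f_{s,t} is increasing on (−α, ∞). -/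
open Real

open Set Filter Topology

lemma sub_one_mul_exp_add_one_pos {y : ℝ} (hy : y ≠ 0) : 0 < (y - 1) * exp y + 1 := by
  have h1 : -y + 1 < exp (-y) := add_one_lt_exp (neg_ne_zero.mpr hy)
  have h2 : exp (-y) * exp y = 1 := by rw [← exp_add]; simp
  nlinarith [exp_pos y]

lemma hasDerivAt_sub_one_mul_exp_add_one {k : ℝ → ℝ} {k' x : ℝ} (hk : HasDerivAt k k' x) :
    HasDerivAt (fun u => (k u - 1) * exp (k u) + 1) (k x * (exp (k x) * k')) x :=
  (((hk.sub_const 1).mul hk.exp).add_const 1).congr_deriv (by ring)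

/-- A quotient of the form `g / ((g' - 1) * exp g' + 1)`, completed at the zero `c` of `g'`, is
increasing as soon as `exp g'` is concave and `g` is strictly convex. -/
lemma monotoneOn_div_sub_one_mul_exp_add_one {a c : ℝ} {g k k' : ℝ → ℝ} (hc : a < c)
    (hg : ∀ x, a < x → HasDerivAt g (k x) x) (hk : ∀ x, a < x → HasDerivAt k (k' x) x)
    (hk' : ∀ x, a < x → 0 < k' x)
    (hK : AntitoneOn (fun x => exp (k x) * k' x) (Ioi a)) (hgc : g c = 0) (hkc : k c = 0) :
    MonotoneOn (fun x => if x = c then 1 / k' c else g x / ((k x - 1) * exp (k x) + 1))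
      (Ioi a) := by
  set K : ℝ → ℝ := fun x => exp (k x) * k' x with hKdef
  set φ : ℝ → ℝ := fun x => (k x - 1) * exp (k x) + 1 with hφdef
  have hφ : ∀ x, a < x → HasDerivAt φ (k x * K x) x := fun x hx =>
    hasDerivAt_sub_one_mul_exp_add_one (hk x hx)
  have hkmono : StrictMonoOn k (Ioi a) := by
    refine strictMonoOn_of_deriv_pos (convex_Ioi a)
      (fun x hx => (hk x hx).continuousAt.continuousWithinAt) fun x hx => ?_
    rw [interior_Ioi] at hx
    rw [(hk x hx).deriv]
    exact hk' x hx
  have hKc : K c = k' c := by simp [hKdef, hkc]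
  have hφc : φ c = 0 := by simp [hφdef, hkc]
  have hφpos : ∀ x, a < x → x ≠ c → 0 < φ x := fun x hx hxc =>
    sub_one_mul_exp_add_one_pos fun h0 => hxc (hkmono.injOn hx hc (h0.trans hkc.symm))
  have hsub : ∀ (m x : ℝ), a < x → HasDerivAt (fun u => φ u - m * g u) (k x * (K x - m)) x :=
    fun m x hx =>
    ((hφ x hx).sub ((hg x hx).const_mul m)).congr_deriv (by ring)
  have mono : ∀ (m x y : ℝ), a < x → x ≤ y → (∀ u ∈ Ioo x y, 0 ≤ k u * (K u - m)) →
      m * (g y - g x) ≤ φ y - φ x := by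
    intro m x y hx hxy hm
    have hM : MonotoneOn (fun u => φ u - m * g u) (Icc x y) := by
      refine monotoneOn_of_deriv_nonneg (convex_Icc x y)
        (fun u hu => (hsub m u (hx.trans_le hu.1)).continuousAt.continuousWithinAt)
        (fun u hu => ?_) fun u hu => ?_
      · rw [interior_Icc] at hu
        exact (hsub m u (hx.trans hu.1)).differentiableAt.differentiableWithinAt
      · rw [interior_Icc] at hu
        rw [(hsub m u (hx.trans hu.1)).deriv]
        exact hm u hu
    have := hM (left_mem_Icc.mpr hxy) (right_mem_Icc.mpr hxy) hxy
    simp only at this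
    linarith
  have anti : ∀ (m x y : ℝ), a < x → x ≤ y → (∀ u ∈ Ioo x y, k u * (K u - m) ≤ 0) →
      φ y - φ x ≤ m * (g y - g x) := by
    intro m x y hx hxy hm
    have hM : AntitoneOn (fun u => φ u - m * g u) (Icc x y) := by
      refine antitoneOn_of_deriv_nonpos (convex_Icc x y)
        (fun u hu => (hsub m u (hx.trans_le hu.1)).continuousAt.continuousWithinAt)
        (fun u hu => ?_) fun u hu => ?_
      · rw [interior_Icc] at hu
        exact (hsub m u (hx.trans hu.1)).differentiableAt.differentiableWithinAt
      · rw [interior_Icc] at hu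
        rw [(hsub m u (hx.trans hu.1)).deriv]
        exact hm u hu
    have := hM (left_mem_Icc.mpr hxy) (right_mem_Icc.mpr hxy) hxy
    simp only at this
    linarith
  have hk_nonneg : ∀ u, c ≤ u → 0 ≤ k u := fun u hu =>
    hkc ▸ hkmono.monotoneOn hc (hc.trans_le hu : a < u) hu
  have hk_nonpos : ∀ u, a < u → u ≤ c → k u ≤ 0 := fun u hu huc =>
    hkc ▸ hkmono.monotoneOn hu hc huc
  have right_lower : ∀ x y, c ≤ x → x ≤ y → K y * (g y - g x) ≤ φ y - φ x := by
    intro x y hx hxy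
    refine mono _ x y (hc.trans_le hx) hxy fun u hu =>
      mul_nonneg (hk_nonneg u (hx.trans hu.1.le)) ?_
    have hu' : a < u := (hc.trans_le hx).trans hu.1
    exact sub_nonneg.mpr (hK hu' (hu'.trans hu.2) hu.2.le)
  have right_upper : ∀ x y, c ≤ x → x ≤ y → φ y - φ x ≤ K x * (g y - g x) := by
    intro x y hx hxy
    refine anti _ x y (hc.trans_le hx) hxy fun u hu =>
      mul_nonpos_of_nonneg_of_nonpos (hk_nonneg u (hx.trans hu.1.le)) ?_
    have hx' : a < x := hc.trans_le hx
    exact sub_nonpos.mpr (hK hx' (hx'.trans hu.1) hu.1.le)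
  have left_lower : ∀ x y, a < x → x ≤ y → y ≤ c → φ y - φ x ≤ K y * (g y - g x) := by
    intro x y hx hxy hy
    refine anti _ x y hx hxy fun u hu =>
      mul_nonpos_of_nonpos_of_nonneg (hk_nonpos u (hx.trans hu.1) (hu.2.le.trans hy)) ?_
    have hu' : a < u := hx.trans hu.1
    exact sub_nonneg.mpr (hK hu' (hu'.trans hu.2) hu.2.le)
  have left_upper : ∀ x y, a < x → x ≤ y → y ≤ c → K x * (g y - g x) ≤ φ y - φ x := by
    intro x y hx hxy hy
    refine mono _ x y hx hxy fun u hu =>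
      mul_nonneg_of_nonpos_of_nonpos (hk_nonpos u (hx.trans hu.1) (hu.2.le.trans hy)) ?_
    exact sub_nonpos.mpr (hK hx (hx.trans hu.1) hu.1.le)
  have hKcpos : 0 < K c := hKc ▸ hk' c hc
  have at_left : ∀ x, a < x → x < c → g x / φ x ≤ 1 / k' c := by
    intro x hx hxc
    have := left_lower x c hx hxc.le le_rfl
    rw [← hKc, div_le_div_iff₀ (hφpos x hx hxc.ne) hKcpos]
    rw [hφc, hgc] at this
    linarith
  have at_right : ∀ x, c < x → 1 / k' c ≤ g x / φ x := by
    intro x hxc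
    have := right_upper c x le_rfl hxc.le
    rw [← hKc, div_le_div_iff₀ hKcpos (hφpos x (hc.trans hxc) hxc.ne')]
    rw [hφc, hgc] at this
    linarith
  intro x (hx : a < x) y (hy : a < y) hxy
  change (if x = c then 1 / k' c else g x / φ x) ≤ (if y = c then 1 / k' c else g y / φ y)
  rcases lt_trichotomy x c with hxc | rfl | hxc
  · rw [if_neg hxc.ne]
    rcases lt_trichotomy y c with hyc | rfl | hyc
    · rw [if_neg hyc.ne, div_le_div_iff₀ (hφpos x hx hxc.ne) (hφpos y hy hyc.ne)]
      have h1 := left_lower x y hx hxy hyc.le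
      have h2 := left_upper y c hy hyc.le le_rfl
      rw [hφc, hgc] at h2
      have hA : AntitoneOn g (Icc x c) := by
        refine antitoneOn_of_deriv_nonpos (convex_Icc x c)
          (fun u hu => (hg u (hx.trans_le hu.1)).continuousAt.continuousWithinAt)
          (fun u hu => ?_) fun u hu => ?_
        · rw [interior_Icc] at hu
          exact (hg u (hx.trans hu.1)).differentiableAt.differentiableWithinAt
        · rw [interior_Icc] at hu
          rw [(hg u (hx.trans hu.1)).deriv]
          exact hk_nonpos u (hx.trans hu.1) hu.2.le
      have hgy : 0 ≤ g y := hgc ▸ hA ⟨hxy, hyc.le⟩ ⟨hxc.le, le_rfl⟩ hyc.le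
      have hgxy : g y ≤ g x := hA ⟨le_rfl, hxc.le⟩ ⟨hxy, hyc.le⟩ hxy
      nlinarith [mul_le_mul_of_nonneg_left h1 hgy,
        mul_le_mul_of_nonneg_right h2 (sub_nonneg.mpr hgxy)]
    · rw [if_pos rfl]
      exact at_left x hx hxc
    · rw [if_neg hyc.ne']
      exact (at_left x hx hxc).trans (at_right y hyc)
  · rw [if_pos rfl]
    split_ifs with hyc
    · exact le_rfl
    · exact at_right y (lt_of_le_of_ne hxy (Ne.symm hyc))
  · have hyc : c < y := hxc.trans_le hxy
    rw [if_neg hxc.ne', if_neg hyc.ne',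
      div_le_div_iff₀ (hφpos x hx hxc.ne') (hφpos y hy hyc.ne')]
    have h1 := right_upper x y hxc.le hxy
    have h2 := right_lower c x le_rfl hxc.le
    rw [hφc, hgc] at h2
    have hG : MonotoneOn g (Icc c y) := by
      refine monotoneOn_of_deriv_nonneg (convex_Icc c y)
        (fun u hu => (hg u (hc.trans_le hu.1)).continuousAt.continuousWithinAt)
        (fun u hu => ?_) fun u hu => ?_
      · rw [interior_Icc] at hu
        exact (hg u (hc.trans hu.1)).differentiableAt.differentiableWithinAt
      · rw [interior_Icc] at hu
        rw [(hg u (hc.trans hu.1)).deriv]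
        exact hk_nonneg u hu.1.le
    have hgx : 0 ≤ g x := hgc ▸ hG ⟨le_rfl, hyc.le⟩ ⟨hxc.le, hxy⟩ hxc.le
    have hgxy : g x ≤ g y := hG ⟨hxc.le, hxy⟩ ⟨hyc.le, le_rfl⟩ hxy
    nlinarith [mul_le_mul_of_nonneg_left h1 hgx,
      mul_le_mul_of_nonneg_right h2 (sub_nonneg.mpr hgxy)]

/-- The digamma function on the real line. -/
noncomputable def realDigamma : ℝ → ℝ := deriv fun x => log (Gamma x)

lemma contDiffAt_log_Gamma {x : ℝ} (hx : 0 < x) :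
    ContDiffAt ℝ 2 (fun y => log (Gamma y)) x := by
  have hC : ContDiffAt ℂ 2 Complex.Gamma (x : ℂ) := by
    have hopen : IsOpen {z : ℂ | 0 < z.re} := isOpen_lt continuous_const Complex.continuous_re
    have hd : DifferentiableOn ℂ Complex.Gamma {z : ℂ | 0 < z.re} := fun z hz =>
      (Complex.differentiableAt_Gamma z fun m hm => by
        have hz' : 0 < z.re := hz
        rw [hm] at hz'
        simp only [Complex.neg_re, Complex.natCast_re] at hz'
        linarith [(Nat.cast_nonneg m : (0 : ℝ) ≤ m)]).differentiableWithinAt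
    exact (hd.analyticAt (hopen.mem_nhds (by simpa using hx))).contDiffAt
  have hR : ContDiffAt ℝ 2 Gamma x := by
    refine hC.real_of_complex.congr_of_eventuallyEq (Eventually.of_forall fun y => ?_)
    simp [Complex.Gamma_ofReal]
  exact hR.log (Gamma_pos_of_pos hx).ne'

lemma hasDerivAt_log_Gamma {x : ℝ} (hx : 0 < x) :
    HasDerivAt (fun y => log (Gamma y)) (realDigamma x) x :=
  ((contDiffAt_log_Gamma hx).differentiableAt (by norm_num)).hasDerivAt

lemma differentiableAt_realDigamma {x : ℝ} (hx : 0 < x) : DifferentiableAt ℝ realDigamma x :=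
  ((contDiffAt_log_Gamma hx).derivWithin (m := 1) (by norm_num)).differentiableAt (by norm_num)

lemma realDigamma_add_one {x : ℝ} (hx : 0 < x) : realDigamma (x + 1) = realDigamma x + 1 / x := by
  have h1 : HasDerivAt (fun y => log (Gamma (y + 1))) (realDigamma (x + 1)) x :=
    (hasDerivAt_log_Gamma (by linarith : 0 < x + 1)).comp_add_const x 1
  have h2 : HasDerivAt (fun y => log y + log (Gamma y)) (x⁻¹ + realDigamma x) x :=
    (hasDerivAt_log hx.ne').add (hasDerivAt_log_Gamma hx)
  have h3 : (fun y => log (Gamma (y + 1))) =ᶠ[𝓝 x] fun y => log y + log (Gamma y) := by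
    filter_upwards [lt_mem_nhds hx] with y hy
    rw [Gamma_add_one hy.ne', log_mul hy.ne' (Gamma_pos_of_pos hy).ne']
  rw [h1.unique (h2.congr_of_eventuallyEq h3), one_div, add_comm]

lemma monotoneOn_realDigamma : MonotoneOn realDigamma (Ioi 0) :=
  convexOn_log_Gamma.monotoneOn_deriv fun _ hx => (hasDerivAt_log_Gamma hx).differentiableAt

lemma realDigamma_add_nat_sub_le {x : ℝ} (hx : 0 < x) (n : ℕ) :
    realDigamma (x + n) - realDigamma x ≤ n / x := by
  induction n with
  | zero => simp
  | succ n ih =>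
    have hn : (0 : ℝ) ≤ n := n.cast_nonneg
    have h1 := realDigamma_add_one (by linarith : 0 < x + n)
    have h2 : 1 / (x + n) ≤ 1 / x := one_div_le_one_div_of_le hx (by linarith)
    push_cast
    rw [← add_assoc, h1, add_div]
    linarith

lemma realDigamma_sub_nonneg {x d : ℝ} (hx : 0 < x) (hd : 0 ≤ d) :
    0 ≤ realDigamma (x + d) - realDigamma x :=
  sub_nonneg.mpr (monotoneOn_realDigamma hx (by simp only [mem_Ioi]; linarith) (by linarith))

lemma tendsto_realDigamma_sub {d : ℝ} (hd : 0 ≤ d) :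
    Tendsto (fun x => realDigamma (x + d) - realDigamma x) atTop (𝓝 0) := by
  obtain ⟨n, hn⟩ := exists_nat_ge d
  refine tendsto_of_tendsto_of_tendsto_of_le_of_le' tendsto_const_nhds
    (tendsto_id.const_div_atTop (n : ℝ)) ?_ ?_
  · filter_upwards [eventually_gt_atTop 0] with x hx using realDigamma_sub_nonneg hx hd
  · filter_upwards [eventually_gt_atTop 0] with x hx
    have h1 : realDigamma (x + d) ≤ realDigamma (x + n) :=
      monotoneOn_realDigamma (by simp only [mem_Ioi]; linarith)
        (by simp only [mem_Ioi]; linarith) (by linarith)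
    exact (sub_le_sub_right h1 _).trans (realDigamma_add_nat_sub_le hx n)

lemma nonneg_of_add_one_le {F B : ℝ → ℝ} (hF : ∀ x, 0 < x → F (x + 1) ≤ F x)
    (hB : ∀ x, 0 < x → B x ≤ F x) (hlim : Tendsto B atTop (𝓝 0)) {x : ℝ} (hx : 0 < x) :
    0 ≤ F x := by
  have hn : ∀ n : ℕ, F (x + n) ≤ F x := by
    intro n
    induction n with
    | zero => simp
    | succ n ih =>
      push_cast
      rw [← add_assoc]
      exact (hF _ (by positivity)).trans ih
  have ht : Tendsto (fun n : ℕ => B (x + n)) atTop (𝓝 0) :=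
    hlim.comp (tendsto_atTop_add_const_left _ x tendsto_natCast_atTop_atTop)
  exact le_of_tendsto' ht fun n => (hB _ (by positivity)).trans (hn n)

lemma realDigamma_sub_add_one {x d : ℝ} (hx : 0 < x) (hd : 0 ≤ d) :
    realDigamma (x + 1 + d) - realDigamma (x + 1) =
      realDigamma (x + d) - realDigamma x - d / (x * (x + d)) := by
  have hxd : 0 < x + d := by linarith
  rw [show x + 1 + d = x + d + 1 by ring, realDigamma_add_one hx, realDigamma_add_one hxd]
  field_simp
  ring

lemma realDigamma_sub_pos {x d : ℝ} (hx : 0 < x) (hd : 0 < d) :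
    0 < realDigamma (x + d) - realDigamma x := by
  have h1 := realDigamma_sub_add_one hx hd.le
  have h2 := realDigamma_sub_nonneg (by linarith : 0 < x + 1) hd.le
  have h3 : 0 < d / (x * (x + d)) := by positivity
  linarith

lemma realDigamma_sub_le {x d : ℝ} (hx : 0 < x) (hd : 1 ≤ d) :
    realDigamma (x + d) - realDigamma x ≤ d * (2 * x + d + 1) / (2 * (x * (x + d))) := by
  refine sub_nonneg.mp (nonneg_of_add_one_le
    (F := fun x => d * (2 * x + d + 1) / (2 * (x * (x + d))) - (realDigamma (x + d) - realDigamma x))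
    (B := fun x => -(realDigamma (x + d) - realDigamma x)) (fun y hy => ?_) (fun y hy => ?_)
    (by simpa using (tendsto_realDigamma_sub (by linarith : 0 ≤ d)).neg) hx)
  · rw [realDigamma_sub_add_one hy (by linarith)]
    have hyd : 0 < y + d := by linarith
    have key : d * (2 * y + d + 1) / (2 * (y * (y + d))) -
        (d * (2 * (y + 1) + d + 1) / (2 * ((y + 1) * (y + 1 + d))) + d / (y * (y + d))) =
        d * (d ^ 2 - 1) / (2 * (y * (y + d)) * ((y + 1) * (y + 1 + d))) := by
      have : 0 < y + 1 + d := by linarith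
      field_simp
      ring
    have : 0 ≤ d * (d ^ 2 - 1) / (2 * (y * (y + d)) * ((y + 1) * (y + 1 + d))) := by
      have : 0 ≤ d ^ 2 - 1 := by nlinarith
      positivity
    linarith
  · have : 0 ≤ d * (2 * y + d + 1) / (2 * (y * (y + d))) := by positivity
    linarith

lemma antitoneOn_realDigamma_sub {d : ℝ} (hd : 0 ≤ d) :
    AntitoneOn (fun x => realDigamma (x + d) - realDigamma x) (Ioi 0) := by
  intro x (hx : 0 < x) y (hy : 0 < y) hxy
  obtain ⟨r, hr, rfl⟩ : ∃ r, 0 ≤ r ∧ y = x + r := ⟨y - x, by linarith, by ring⟩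
  have hlim := tendsto_realDigamma_sub hd
  refine sub_nonneg.mp (nonneg_of_add_one_le
    (F := fun x => (realDigamma (x + d) - realDigamma x) -
      (realDigamma (x + r + d) - realDigamma (x + r)))
    (B := fun x => (realDigamma (x + d) - realDigamma x) -
      (realDigamma (x + r + d) - realDigamma (x + r))) (fun z hz => ?_) (fun _ _ => le_rfl) ?_ hx)
  · rw [show z + 1 + r = z + r + 1 by ring, realDigamma_sub_add_one hz hd,
      realDigamma_sub_add_one (by linarith : 0 < z + r) hd]
    have : d / ((z + r) * (z + r + d)) ≤ d / (z * (z + d)) := by gcongr <;> linarith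
    linarith
  · simpa using hlim.sub (hlim.comp (tendsto_atTop_add_const_right _ r tendsto_id))

lemma deriv_realDigamma_add_one {x : ℝ} (hx : 0 < x) :
    deriv realDigamma (x + 1) = deriv realDigamma x - 1 / x ^ 2 := by
  have h1 : HasDerivAt (fun y => realDigamma (y + 1)) (deriv realDigamma (x + 1)) x :=
    (differentiableAt_realDigamma (by linarith : 0 < x + 1)).hasDerivAt.comp_add_const x 1
  have h2 : HasDerivAt (fun y => realDigamma y + y⁻¹) (deriv realDigamma x + -(x ^ 2)⁻¹) x :=
    (differentiableAt_realDigamma hx).hasDerivAt.add (hasDerivAt_inv hx.ne')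
  have h3 : (fun y => realDigamma (y + 1)) =ᶠ[𝓝 x] fun y => realDigamma y + y⁻¹ := by
    filter_upwards [lt_mem_nhds hx] with y hy
    rw [realDigamma_add_one hy, one_div]
  rw [h1.unique (h2.congr_of_eventuallyEq h3), one_div, sub_eq_add_neg]

lemma deriv_realDigamma_sub_nonpos {x d : ℝ} (hx : 0 < x) (hd : 0 ≤ d) :
    deriv realDigamma (x + d) - deriv realDigamma x ≤ 0 := by
  have h1 : HasDerivAt (fun y => realDigamma (y + d) - realDigamma y)
      (deriv realDigamma (x + d) - deriv realDigamma x) x :=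
    ((differentiableAt_realDigamma (by linarith : 0 < x + d)).hasDerivAt.comp_add_const x d).sub
      (differentiableAt_realDigamma hx).hasDerivAt
  rw [← h1.deriv, ← derivWithin_of_isOpen isOpen_Ioi (show x ∈ Ioi (0 : ℝ) from hx)]
  exact (antitoneOn_realDigamma_sub hd).derivWithin_nonpos

lemma sq_realDigamma_sub_add_le {x d : ℝ} (hx : 0 < x) (hd : 1 ≤ d) :
    (realDigamma (x + d) - realDigamma x) ^ 2 +
      d * (deriv realDigamma (x + d) - deriv realDigamma x) ≤ 0 := by
  have hd0 : 0 ≤ d := by linarith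
  refine neg_nonneg.mp (nonneg_of_add_one_le
    (F := fun x => -((realDigamma (x + d) - realDigamma x) ^ 2 +
      d * (deriv realDigamma (x + d) - deriv realDigamma x)))
    (B := fun x => -(realDigamma (x + d) - realDigamma x) ^ 2) (fun y hy => ?_) (fun y hy => ?_)
    (by simpa using ((tendsto_realDigamma_sub hd0).pow 2).neg) hx)
  · have hyd : 0 < y + d := by linarith
    have h1 := realDigamma_sub_le hy hd
    rw [realDigamma_sub_add_one hy hd0, show y + 1 + d = y + d + 1 by ring,
      deriv_realDigamma_add_one hy, deriv_realDigamma_add_one hyd]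
    set D := realDigamma (y + d) - realDigamma y
    have he : 0 ≤ d / (y * (y + d)) := by positivity
    have h2 := mul_nonneg he (sub_nonneg.mpr h1)
    have h3 : d * (1 / y ^ 2 - 1 / (y + d) ^ 2) + (d / (y * (y + d))) ^ 2 =
        d / (y * (y + d)) * (2 * (d * (2 * y + d + 1) / (2 * (y * (y + d))))) := by
      field_simp
      ring
    nlinarith
  · have := mul_nonneg hd0 (neg_nonneg.mpr (deriv_realDigamma_sub_nonpos hy hd0))
    linarith

/-- The normalised integrand of `gAux`, written through `log ∘ Gamma`. -/
lemma log_Gamma_ratio {s t c u : ℝ} (hs : 0 < u + s) (ht : 0 < u + t) (hcs : 0 < c + s)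
    (hct : 0 < c + t) :
    log (Gamma (u + t) / Gamma (u + s) * (Gamma (c + s) / Gamma (c + t))) =
      (log (Gamma (u + t)) - log (Gamma (u + s))) -
        (log (Gamma (c + t)) - log (Gamma (c + s))) := by
  have h1 := (Gamma_pos_of_pos hs).ne'
  have h2 := (Gamma_pos_of_pos ht).ne'
  have h3 := (Gamma_pos_of_pos hcs).ne'
  have h4 := (Gamma_pos_of_pos hct).ne'
  rw [log_mul (div_ne_zero h2 h1) (div_ne_zero h3 h4), log_div h2 h1, log_div h3 h4]
  ring

lemma gAux_comm (s t c : ℝ) : gAux s t c = gAux t s c := by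
  funext x
  have h : ∀ u, log (Gamma (u + t) / Gamma (u + s) * (Gamma (c + s) / Gamma (c + t))) =
      -log (Gamma (u + s) / Gamma (u + t) * (Gamma (c + t) / Gamma (c + s))) := by
    intro u
    rw [← log_inv, mul_inv, inv_div, inv_div]
  unfold gAux
  simp_rw [h]
  rw [intervalIntegral.integral_neg, ← neg_sub s t, one_div_neg_eq_neg_one_div]
  ring

lemma hasDerivAt_gAux {s t c x : ℝ} (hst : s < t) (hc : -s < c) (hx : -s < x) :
    HasDerivAt (gAux s t c)
      (1 / (t - s) * ((log (Gamma (x + t)) - log (Gamma (x + s))) -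
        (log (Gamma (c + t)) - log (Gamma (c + s))))) x := by
  set F : ℝ → ℝ := fun u =>
    log (Gamma (u + t) / Gamma (u + s) * (Gamma (c + s) / Gamma (c + t))) with hF
  have hFx : ∀ u, -s < u → F u = (log (Gamma (u + t)) - log (Gamma (u + s))) -
      (log (Gamma (c + t)) - log (Gamma (c + s))) := fun u hu =>
    log_Gamma_ratio (by linarith) (by linarith) (by linarith) (by linarith)
  have hcont : ContinuousOn F (Ioi (-s)) := by
    refine ContinuousOn.congr (fun u hu => ?_) hFx
    have hu : -s < u := hu
    exact ((((hasDerivAt_log_Gamma (by linarith : 0 < u + t)).comp_add_const u t).sub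
      ((hasDerivAt_log_Gamma (by linarith : 0 < u + s)).comp_add_const u s)).sub_const
        _).continuousAt.continuousWithinAt
  rw [← hFx x hx]
  refine HasDerivAt.const_mul _ (intervalIntegral.integral_hasDerivAt_right ?_ ?_ ?_)
  · exact (hcont.mono (ordConnected_Ioi.uIcc_subset hc hx)).intervalIntegrable
  · exact hcont.stronglyMeasurableAtFilter isOpen_Ioi x hx
  · exact hcont.continuousAt (isOpen_Ioi.mem_nhds hx)

lemma fAux_monotoneOn_of_lt {s t c : ℝ} (h : 1 < t - s) (hc : -s < c) :
    MonotoneOn (fAux s t c) (Ioi (-s)) := by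
  have hst : s < t := by linarith
  have hts : 0 < t - s := by linarith
  set k : ℝ → ℝ := fun x => 1 / (t - s) * ((log (Gamma (x + t)) - log (Gamma (x + s))) -
    (log (Gamma (c + t)) - log (Gamma (c + s)))) with hkdef
  set k' : ℝ → ℝ := fun x => 1 / (t - s) * (realDigamma (x + t) - realDigamma (x + s)) with hk'def
  have hg : ∀ x, -s < x → HasDerivAt (gAux s t c) (k x) x := fun x hx => hasDerivAt_gAux hst hc hx
  have hk : ∀ x, -s < x → HasDerivAt k (k' x) x := fun x hx =>
    ((((hasDerivAt_log_Gamma (by linarith : 0 < x + t)).comp_add_const x t).sub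
      ((hasDerivAt_log_Gamma (by linarith : 0 < x + s)).comp_add_const x s)).sub_const
        _).const_mul _
  have hk2 : ∀ x, -s < x → HasDerivAt k'
      (1 / (t - s) * (deriv realDigamma (x + t) - deriv realDigamma (x + s))) x := fun x hx =>
    (((differentiableAt_realDigamma (by linarith : 0 < x + t)).hasDerivAt.comp_add_const x t).sub
      ((differentiableAt_realDigamma
        (by linarith : 0 < x + s)).hasDerivAt.comp_add_const x s)).const_mul _
  have hshift : ∀ x, x + t = x + s + (t - s) := fun x => by ring
  have hpos : ∀ x, -s < x → 0 < k' x := by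
    intro x hx
    have := realDigamma_sub_pos (by linarith : 0 < x + s) hts
    simp only [hk'def]
    rw [hshift]
    positivity
  have hprod : ∀ x, -s < x → HasDerivAt (fun u => exp (k u) * k' u)
      (exp (k x) * k' x * k' x + exp (k x) *
        (1 / (t - s) * (deriv realDigamma (x + t) - deriv realDigamma (x + s)))) x := fun x hx =>
    (hk x hx).exp.mul (hk2 x hx)
  have hK : AntitoneOn (fun x => exp (k x) * k' x) (Ioi (-s)) := by
    refine antitoneOn_of_deriv_nonpos (convex_Ioi _)
      (fun x hx => (hprod x hx).continuousAt.continuousWithinAt) (fun x hx => ?_) fun x hx => ?_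
    · rw [interior_Ioi] at hx
      exact (hprod x hx).differentiableAt.differentiableWithinAt
    · rw [interior_Ioi] at hx
      have hx' : 0 < x + s := by linarith [mem_Ioi.mp hx]
      rw [(hprod x hx).deriv]
      have hkey := sq_realDigamma_sub_add_le hx' h.le
      rw [← hshift] at hkey
      have : exp (k x) * k' x * k' x + exp (k x) *
          (1 / (t - s) * (deriv realDigamma (x + t) - deriv realDigamma (x + s))) =
          exp (k x) / (t - s) ^ 2 * ((realDigamma (x + t) - realDigamma (x + s)) ^ 2 +
            (t - s) * (deriv realDigamma (x + t) - deriv realDigamma (x + s))) := by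
        simp only [hk'def]
        field_simp
      rw [this]
      exact mul_nonpos_of_nonneg_of_nonpos (by positivity) hkey
  have hderiv : ∀ x, -s < x → deriv (gAux s t c) x = k x := fun x hx => (hg x hx).deriv
  have hderiv2 : deriv (deriv (gAux s t c)) c = k' c := by
    have : deriv (gAux s t c) =ᶠ[𝓝 c] k := by
      filter_upwards [lt_mem_nhds hc] with x hx using hderiv x hx
    rw [this.deriv_eq, (hk c hc).deriv]
  refine (monotoneOn_div_sub_one_mul_exp_add_one hc hg hk hpos hK (by simp [gAux])
    (by simp [hkdef])).congr fun x hx => ?_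
  simp only [fAux, hderiv2, hderiv x hx]

/-- For `|s − t| > 1` and `c ∈ (−min{s,t}, ∞)`, the function `f_{s,t}` is
increasing on `(−min{s,t}, ∞)`. -/
theorem fAux_monotoneOn (s t c : ℝ) (h : |s - t| > 1)
    (hc : c ∈ Set.Ioi (-(min s t))) :
    MonotoneOn (fAux s t c) (Set.Ioi (-(min s t))) := by
  rcases lt_abs.mp h with h | h
  · have hcomm : fAux s t c = fAux t s c := by
      funext x
      simp only [fAux, gAux_comm s t]
    rw [min_eq_right (by linarith)] at hc ⊢
    rw [hcomm]
    exact fAux_monotoneOn_of_lt h hc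
  · rw [min_eq_left (by linarith)] at hc ⊢
    exact fAux_monotoneOn_of_lt (by linarith) hc
end
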